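/- Let d ≥ 1, m > 1, m* = m/(m−1), and suppose (b,V) satisfies hypothesis (H1) with parameters δ > 0, ρ > 0, a ∈ ℝ, η > 0, R > 0. Then lim_{β→∞} β^{−δm*/(δm*+η)} λ_max(β) = c₀, where c₀ := ((δm*+η)/(δm*)) · (ρ^{m*} δ/η)^{η/(δm*+η)}. -/

import Mathlib

open Filter Real RealInnerProductSpace

noncomputable section

abbrev Euc (d : ℕ) := EuclideanSpace ℝ (Fin d)

/-- The Laplacian of `φ`, defined as the sum of the second partial derivatives
in the coordinate directions. -/
def lap {d : ℕ} (φ : Euc d → ℝ) (x : Euc d) : ℝ :=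
  ∑ i : Fin d, fderiv ℝ (fun y => fderiv ℝ φ y (EuclideanSpace.single i 1)) x
    (EuclideanSpace.single i 1)

/-- `(lam, φ)` is a subsolution of the ergodic problem (EP). -/
def IsSubsol {d : ℕ} (m : ℝ) (b : Euc d → Euc d) (V : Euc d → ℝ) (β lam : ℝ)
    (φ : Euc d → ℝ) : Prop :=
  ContDiff ℝ 3 φ ∧ ∀ x : Euc d,
    lam - lap φ x + ⟪b x, gradient φ x⟫ + (1 / m) * ‖gradient φ x‖ ^ m - β * V x ≤ 0

/-- The generalized principal eigenvalue `λ_max(β)`. -/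
def lamMax {d : ℕ} (m : ℝ) (b : Euc d → Euc d) (V : Euc d → ℝ) (β : ℝ) : ℝ :=
  sSup {lam : ℝ | ∃ φ : Euc d → ℝ, IsSubsol m b V β lam φ}

/-- Hypothesis (H0) with parameter `δ` and constants `ρ, R` and auxiliary function `α`. -/
def HypH0 {d : ℕ} (δ ρ R : ℝ) (b : Euc d → Euc d) (V : Euc d → ℝ) (α : Euc d → ℝ) : Prop :=
  ContDiff ℝ 2 b ∧ ContDiff ℝ 2 V ∧ (∃ M : ℝ, ∀ x : Euc d, ‖gradient V x‖ ≤ M) ∧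
  ContDiff ℝ 2 α ∧
  (∀ x : Euc d, R ≤ ‖x‖ → b x = ((ρ + α x) * ‖x‖ ^ (δ - 1)) • x) ∧
  Tendsto α (cocompact (Euc d)) (nhds 0) ∧
  (∀ x : Euc d, 0 ≤ V x) ∧
  Metric.closedBall (0 : Euc d) R ⊆ interior (Function.support V) ∧
  Tendsto V (cocompact (Euc d)) (nhds 0)

/-- Hypothesis (H1): (H0) together with `α(x) = a|x|⁻¹` and `V(x) = |x|^{-η}` outside `B_R`. -/
def HypH1 {d : ℕ} (δ ρ R a η : ℝ) (b : Euc d → Euc d) (V : Euc d → ℝ) (α : Euc d → ℝ) : Prop :=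
  HypH0 δ ρ R b V α ∧
  ∀ x : Euc d, R ≤ ‖x‖ → α x = a * ‖x‖⁻¹ ∧ V x = ‖x‖ ^ (-η)

open MeasureTheory in
lemma aux_ibp {d : ℕ} (ψ φ : Euc d → ℝ) (hψ : ContDiff ℝ 1 ψ) (hc : HasCompactSupport ψ)
    (hφ : ContDiff ℝ 3 φ) :
    Continuous (lap φ) ∧ Continuous (fun x => fderiv ℝ ψ x (gradient φ x)) ∧
    ∫ x, (ψ x * lap φ x + fderiv ℝ ψ x (gradient φ x)) = 0 := by
  have hgi : ∀ i : Fin d, ContDiff ℝ 2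
      (fun y => fderiv ℝ φ y (EuclideanSpace.single i (1:ℝ))) := by
    intro i
    exact (hφ.fderiv_right (m := 2) (by norm_num)).clm_apply contDiff_const
  have hcont : ∀ i : Fin d, Continuous (fun x => fderiv ℝ (fun y => fderiv ℝ φ y
      (EuclideanSpace.single i (1:ℝ))) x (EuclideanSpace.single i (1:ℝ))) := by
    intro i
    exact ((hgi i).continuous_fderiv (by norm_num)).clm_apply continuous_const
  have hψc : ∀ v : Euc d, Continuous (fun x => fderiv ℝ ψ x v) := fun v =>
    (hψ.continuous_fderiv (by norm_num)).clm_apply continuous_const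
  have hexp : ∀ x, fderiv ℝ ψ x (gradient φ x) = ∑ i : Fin d,
      fderiv ℝ ψ x (EuclideanSpace.single i (1:ℝ)) * fderiv ℝ φ x (EuclideanSpace.single i (1:ℝ)) := by
    intro x
    have h1 := (EuclideanSpace.basisFun (Fin d) ℝ).sum_repr (gradient φ x)
    conv_lhs => rw [← h1]
    rw [map_sum]
    refine Finset.sum_congr rfl fun i _ => ?_
    rw [map_smul, smul_eq_mul, mul_comm, ← inner_gradient_left (f := φ)]
    congr 1
    · simp
    · rw [EuclideanSpace.inner_single_right]
      simp
  refine ⟨?_, ?_, ?_⟩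
  · exact continuous_finsetSum _ fun i _ => hcont i
  · simp_rw [hexp]
    exact continuous_finsetSum _ fun i _ => (hψc _).mul (hgi i).continuous
  · have hfc : ∀ v : Euc d, HasCompactSupport (fun x => fderiv ℝ ψ x v) := fun v =>
      hc.fderiv_apply (𝕜 := ℝ) v
    have e1 : ∀ i : Fin d, Integrable (fun x => ψ x * fderiv ℝ (fun y => fderiv ℝ φ y
      (EuclideanSpace.single i (1:ℝ))) x (EuclideanSpace.single i (1:ℝ))) := fun i =>
        (hψ.continuous.mul (hcont i)).integrable_of_hasCompactSupport hc.mul_right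
    have e2 : ∀ i : Fin d, Integrable (fun x => fderiv ℝ ψ x (EuclideanSpace.single i (1:ℝ)) *
        fderiv ℝ φ x (EuclideanSpace.single i (1:ℝ))) := fun i =>
        ((hψc _).mul (hgi i).continuous).integrable_of_hasCompactSupport (hfc _).mul_right
    have : ∀ x, ψ x * lap φ x + fderiv ℝ ψ x (gradient φ x) = ∑ i : Fin d,
        (ψ x * fderiv ℝ (fun y => fderiv ℝ φ y
          (EuclideanSpace.single i (1:ℝ))) x (EuclideanSpace.single i (1:ℝ)) +
        fderiv ℝ ψ x (EuclideanSpace.single i (1:ℝ)) *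
          fderiv ℝ φ x (EuclideanSpace.single i (1:ℝ))) := by
      intro x
      rw [hexp, lap, Finset.mul_sum, ← Finset.sum_add_distrib]
    simp_rw [this]
    rw [integral_finsetSum]
    swap
    · exact fun i _ => (e1 i).add (e2 i)
    refine Finset.sum_eq_zero fun i _ => ?_
    rw [integral_add (e1 i) (e2 i), integral_mul_fderiv_eq_neg_fderiv_mul_of_integrable (e2 i) (e1 i)]
    · ring
    · exact (hψ.continuous.mul (hgi i).continuous).integrable_of_hasCompactSupport hc.mul_right
    · intro x _; exact (hψ.differentiable (by norm_num)) x
    · intro x _; exact ((hgi i).differentiable (by norm_num)) x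

open MeasureTheory in
lemma aux_bump (d : ℕ) (m : ℝ) (hm : 1 < m) : ∃ (ψ : Euc d → ℝ) (K : ℝ), 0 ≤ K ∧
    ContDiff ℝ 1 ψ ∧ HasCompactSupport ψ ∧ (∀ x, 0 ≤ ψ x) ∧
    (∀ x, ψ x ≠ 0 → ‖x‖ ≤ 1) ∧ 0 < ∫ x, ψ x ∧ ∀ x, ‖fderiv ℝ ψ x‖ ≤ K * ψ x ^ (1 / m) := by
  let χ : ContDiffBump (0 : Euc d) := ⟨1/2, 1, by norm_num, by norm_num⟩
  obtain ⟨k, hk⟩ := exists_nat_ge (m / (m - 1))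
  have hm1 : 0 < m - 1 := by linarith
  have hk' : m ≤ k * (m - 1) := by rwa [div_le_iff₀ hm1] at hk
  have hk0 : 0 < k := by
    rcases Nat.eq_zero_or_pos k with h | h
    · subst h; simp at hk'; linarith
    · exact h
  have hχ : ContDiff ℝ 1 χ := χ.contDiff
  have hcs : HasCompactSupport (χ : Euc d → ℝ) := χ.hasCompactSupport
  obtain ⟨M, hM⟩ := (hcs.fderiv (𝕜 := ℝ)).exists_bound_of_continuous
    (hχ.continuous_fderiv (by norm_num))
  have hM0 : 0 ≤ M := le_trans (norm_nonneg _) (hM 0)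
  have hcsk : HasCompactSupport (fun x => χ x ^ k) := by
    refine hcs.mono' ?_
    intro x hx
    apply subset_tsupport
    intro h0
    apply hx
    simp [h0, hk0.ne']
  refine ⟨fun x => χ x ^ k, k * M, by positivity, hχ.pow k, hcsk, fun x => pow_nonneg χ.nonneg _,
    ?_, ?_, ?_⟩
  · intro x hx
    by_contra h
    push Not at h
    apply hx
    have : χ x = 0 := χ.zero_of_le_dist (by simpa using h.le)
    simp [this, hk0.ne']
  · refine Continuous.integral_pos_of_hasCompactSupport_nonneg_nonzero (x := 0) (hχ.pow k).continuous hcsk (fun x => pow_nonneg χ.nonneg _) ?_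
    have : χ (0 : Euc d) = 1 := χ.one_of_mem_closedBall (by simp [χ])
    simp [this]
  · intro x
    have h1 : HasFDerivAt (fun x => χ x ^ k) ((k * χ x ^ (k-1)) • fderiv ℝ χ x) x := by
      have := ((hχ.differentiable (by norm_num)) x).hasFDerivAt.pow k
      simpa using this
    rw [h1.fderiv, norm_smul, Real.norm_of_nonneg (by have := χ.nonneg' x; positivity)]
    have h0 : 0 ≤ χ x := χ.nonneg
    have h2 : χ x ^ (k-1) ≤ (χ x ^ k) ^ (1 / m) := by
      rcases h0.eq_or_lt with h | h
      · rw [← h]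
        have : 1 < k := by
          by_contra hc
          have : k = 1 := by omega
          subst this
          simp at hk'; linarith
        rw [zero_pow (by omega)]
        positivity
      · rw [← Real.rpow_natCast, ← Real.rpow_natCast, ← Real.rpow_mul h0]
        apply Real.rpow_le_rpow_of_exponent_ge h χ.le_one
        rw [Nat.cast_pred hk0, mul_one_div, div_le_iff₀ (by linarith)]
        nlinarith
    calc _ ≤ (k * (χ x ^ k) ^ (1 / m)) * M := by
          gcongr
          exact hM x
      _ = _ := by ring

open MeasureTheory in
lemma aux_upper (d : ℕ) (m mst : ℝ) (hm : 1 < m) (hmst : mst = m / (m - 1)) (μ : ℝ) (hμ0 : 0 < μ)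
    (hμ1 : μ < 1) : ∃ C : ℝ, ∀ (b : Euc d → Euc d) (V : Euc d → ℝ) (β lam : ℝ) (φ : Euc d → ℝ)
      (x₀ : Euc d) (B W : ℝ), 0 ≤ β → 0 ≤ B → (∀ x, ‖x - x₀‖ ≤ 1 → ‖b x‖ ≤ B ∧ V x ≤ W) →
      IsSubsol m b V β lam φ → lam ≤ C + (B / μ) ^ mst / mst + β * W := by
  obtain ⟨ψ, K, hK, hψ, hψc, hψ0, hψ1, hI, hD⟩ := aux_bump d m hm
  have hm0 : 0 < m := by linarith
  have hconj : m.HolderConjugate mst := by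
    rw [hmst]; exact Real.HolderConjugate.conjExponent hm
  have hmst0 : 0 < mst := hconj.symm.pos
  have hμm : 0 < 1 - μ ^ m := by
    have := Real.rpow_lt_one hμ0.le hμ1 hm0
    linarith
  set σ : ℝ := (1 - μ ^ m) ^ (1 / m) with hσ
  have hσ0 : 0 < σ := by positivity
  have hσm : σ ^ m = 1 - μ ^ m := by
    rw [hσ, ← Real.rpow_mul hμm.le, one_div, inv_mul_cancel₀ hm0.ne', Real.rpow_one]
  set C0 : ℝ := (K / σ) ^ mst / mst with hC0
  have hC00 : 0 ≤ C0 := by positivity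
  set I : ℝ := ∫ x, ψ x with hIdef
  set A : ℝ := ∫ x : Euc d, (Metric.closedBall (0 : Euc d) 1).indicator (fun _ => C0) x with hA
  have hindInt : Integrable (fun x : Euc d => (Metric.closedBall (0 : Euc d) 1).indicator (fun _ => C0) x) := by
    rw [integrable_indicator_iff Metric.isClosed_closedBall.measurableSet]
    exact integrableOn_const (measure_closedBall_lt_top.ne)
  refine ⟨A / I, ?_⟩
  intro b V β lam φ x₀ B W hβ hB hbV ⟨hφ, hsub⟩
  -- translate
  set Ψ : Euc d → ℝ := fun x => ψ (x - x₀) with hΨ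
  have hΨd : ContDiff ℝ 1 Ψ := hψ.comp (contDiff_id.sub contDiff_const)
  have hΨc : HasCompactSupport Ψ := hψc.comp_homeomorph (Homeomorph.subRight x₀)
  have hΨD : ∀ x, ‖fderiv ℝ Ψ x‖ ≤ K * Ψ x ^ (1 / m) := by
    intro x
    have : fderiv ℝ Ψ x = fderiv ℝ ψ (x - x₀) := fderiv_comp_sub x₀
    rw [this]; exact hD _
  obtain ⟨hc1, hc2, hint⟩ := aux_ibp Ψ φ hΨd hΨc hφ
  set Q : ℝ := (B / μ) ^ mst / mst + β * W with hQ
  have key : ∀ x, lam * Ψ x ≤ (Ψ x * lap φ x + fderiv ℝ Ψ x (gradient φ x)) + (Q * Ψ x +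
      (Metric.closedBall (0 : Euc d) 1).indicator (fun _ => C0) (x - x₀)) := by
    intro x
    have hΨx : 0 ≤ Ψ x := hψ0 _
    by_cases hz : Ψ x = 0
    · have h1 : fderiv ℝ Ψ x = 0 := by
        have := hΨD x
        rw [hz, Real.zero_rpow (by positivity), mul_zero] at this
        exact norm_le_zero_iff.1 this
      rw [hz, h1]
      simp only [mul_zero, zero_mul, zero_add, zero_apply]
      exact Set.indicator_nonneg (fun _ _ => hC00) _
    · have hx1 : ‖x - x₀‖ ≤ 1 := hψ1 _ hz
      obtain ⟨hb, hV⟩ := hbV x hx1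
      rw [Set.indicator_of_mem (by simpa using hx1)]
      set p := gradient φ x with hp
      have hp0 : 0 ≤ ‖p‖ := norm_nonneg p
      have s1 := hsub x
      have s2 : -⟪b x, p⟫ ≤ B * ‖p‖ := by
        have := abs_real_inner_le_norm (b x) p
        have h3 := neg_abs_le (⟪b x, p⟫)
        have : ‖b x‖ * ‖p‖ ≤ B * ‖p‖ := by gcongr
        linarith
      have y1 : B * ‖p‖ ≤ μ ^ m * ‖p‖ ^ m / m + (B / μ) ^ mst / mst := by
        have := Real.young_inequality_of_nonneg (a := μ * ‖p‖) (b := B / μ) (by positivity)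
          (by positivity) hconj
        rw [Real.mul_rpow hμ0.le hp0] at this
        calc B * ‖p‖ = μ * ‖p‖ * (B / μ) := by field_simp
          _ ≤ _ := this
      have y2 : -(fderiv ℝ Ψ x p) ≤ (1 - μ ^ m) * (Ψ x * ‖p‖ ^ m) / m + C0 := by
        have h1 : -(fderiv ℝ Ψ x p) ≤ K * (Ψ x ^ (1 / m) * ‖p‖) := by
          calc -(fderiv ℝ Ψ x p) ≤ ‖fderiv ℝ Ψ x p‖ := neg_le_abs _
            _ ≤ ‖fderiv ℝ Ψ x‖ * ‖p‖ := ContinuousLinearMap.le_opNorm _ _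
            _ ≤ K * Ψ x ^ (1 / m) * ‖p‖ := by gcongr; exact hΨD x
            _ = _ := by ring
        have h2 := Real.young_inequality_of_nonneg (a := σ * (Ψ x ^ (1 / m) * ‖p‖)) (b := K / σ)
          (by positivity) (by positivity) hconj
        rw [Real.mul_rpow hσ0.le (by positivity), Real.mul_rpow (by positivity) hp0,
          ← Real.rpow_mul hΨx, one_div, inv_mul_cancel₀ hm0.ne', Real.rpow_one, hσm] at h2
        have h3 : σ * (Ψ x ^ (m⁻¹) * ‖p‖) * (K / σ) = K * (Ψ x ^ (1 / m) * ‖p‖) := by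
          rw [one_div]; field_simp
        linarith
      have hVW : β * V x ≤ β * W := by gcongr
      have s3 : lam ≤ lap φ x + (μ ^ m * ‖p‖ ^ m / m - 1 / m * ‖p‖ ^ m) + Q := by
        rw [hQ]; linarith
      have s4 := mul_le_mul_of_nonneg_left s3 hΨx
      have s5 : Ψ x * (lap φ x + (μ ^ m * ‖p‖ ^ m / m - 1 / m * ‖p‖ ^ m) + Q) =
        Ψ x * lap φ x - (1 - μ ^ m) * (Ψ x * ‖p‖ ^ m) / m + Q * Ψ x := by ring
      linarith
  have i1 : Integrable Ψ := hΨd.continuous.integrable_of_hasCompactSupport hΨc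
  have i2 : Integrable (fun x => Ψ x * lap φ x + fderiv ℝ Ψ x (gradient φ x)) := by
    refine ((hΨd.continuous.mul hc1).integrable_of_hasCompactSupport hΨc.mul_right).add
      (hc2.integrable_of_hasCompactSupport ?_)
    refine (hΨc.fderiv (𝕜 := ℝ)).mono ?_
    intro x hx h0
    apply hx
    simp [h0]
  have i3 : Integrable (fun x => (Metric.closedBall (0 : Euc d) 1).indicator (fun _ => C0) (x - x₀)) :=
    hindInt.comp_sub_right x₀
  have i4 : Integrable (fun x => Q * Ψ x +
      (Metric.closedBall (0 : Euc d) 1).indicator (fun _ => C0) (x - x₀)) := (i1.const_mul Q).add i3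
  have hmono := integral_mono (i1.const_mul lam) (i2.add i4) key
  simp only [Pi.add_apply] at hmono
  have hΨI : ∫ x, Ψ x = I := integral_sub_right_eq_self ψ x₀
  have hAA : ∫ x, (Metric.closedBall (0 : Euc d) 1).indicator (fun _ => C0) (x - x₀) = A :=
    integral_sub_right_eq_self (fun x => (Metric.closedBall (0 : Euc d) 1).indicator (fun _ => C0) x) x₀
  rw [integral_add i2 i4, hint, integral_add (i1.const_mul Q) i3, integral_const_mul,
    integral_const_mul, hΨI, hAA] at hmono
  have : lam ≤ A / I + Q := by
    rw [← sub_le_iff_le_add, le_div_iff₀ hI]; linarith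
  rw [hQ] at this
  linarith

lemma aux_min_le (D η P β r : ℝ) (hD : 0 < D) (hη : 0 < η) (hP : 0 < P) (hβ : 0 < β) (hr : 0 < r) :
    ((D + η) / D) * (P * D / η) ^ (η / (D + η)) * β ^ (D / (D + η)) ≤ P * r ^ D + β * r ^ (-η) := by
  have hs : 0 < D + η := by positivity
  have h := Real.geom_mean_le_arith_mean2_weighted (w₁ := η / (D + η)) (w₂ := D / (D + η))
    (p₁ := P * r ^ D * (D + η) / η) (p₂ := β * r ^ (-η) * (D + η) / D) (by positivity) (by positivity)
    (by positivity) (by positivity) (by field_simp; ring)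
  have e1 : η / (D + η) * (P * r ^ D * (D + η) / η) = P * r ^ D := by field_simp
  have e2 : D / (D + η) * (β * r ^ (-η) * (D + η) / D) = β * r ^ (-η) := by field_simp
  rw [e1, e2] at h
  refine le_trans (le_of_eq ?_) h
  have f1 : P * r ^ D * (D + η) / η = (P * D / η) * r ^ D * ((D + η) / D) := by field_simp
  have f2 : β * r ^ (-η) * (D + η) / D = β * r ^ (-η) * ((D + η) / D) := by ring
  rw [f1, f2, Real.mul_rpow (by positivity) (by positivity), Real.mul_rpow (by positivity) (by positivity),
    Real.mul_rpow (by positivity) (by positivity), Real.mul_rpow (by positivity) (by positivity),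
    ← Real.rpow_mul hr.le, ← Real.rpow_mul hr.le]
  have g1 : r ^ (D * (η / (D + η))) * r ^ (-η * (D / (D + η))) = 1 := by
    rw [← Real.rpow_add hr]
    have : D * (η / (D + η)) + -η * (D / (D + η)) = 0 := by ring
    rw [this, Real.rpow_zero]
  have g2 : ((D + η) / D) ^ (η / (D + η)) * ((D + η) / D) ^ (D / (D + η)) = (D + η) / D := by
    rw [← Real.rpow_add (by positivity)]
    have : η / (D + η) + D / (D + η) = 1 := by field_simp; ring
    rw [this, Real.rpow_one]
  calc _ = (r ^ (D * (η / (D + η))) * r ^ (-η * (D / (D + η)))) *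
      (((D + η) / D) ^ (η / (D + η)) * ((D + η) / D) ^ (D / (D + η))) *
        ((P * D / η) ^ (η / (D + η)) * β ^ (D / (D + η))) := by rw [g1, g2]; ring
    _ = _ := by ring

lemma aux_min_eq (D η P β r : ℝ) (hD : 0 < D) (hη : 0 < η) (hP : 0 < P) (hβ : 0 < β)
    (hr : r = (η * β / (P * D)) ^ (1 / (D + η))) :
    P * r ^ D + β * r ^ (-η) = ((D + η) / D) * (P * D / η) ^ (η / (D + η)) * β ^ (D / (D + η)) := by
  have hs : 0 < D + η := by positivity
  have hr0 : 0 < r := by rw [hr]; positivity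
  have h1 : r ^ (D + η) = η * β / (P * D) := by
    rw [hr, ← Real.rpow_mul (by positivity), one_div, inv_mul_cancel₀ hs.ne', Real.rpow_one]
  have h2 : r ^ D = r ^ (-η) * (η * β / (P * D)) := by
    rw [← h1, ← Real.rpow_add hr0]; congr 1; ring
  have h3 : β * r ^ (-η) = (P * D / η) ^ (η / (D + η)) * β ^ (D / (D + η)) := by
    rw [hr, ← Real.rpow_mul (by positivity)]
    have : 1 / (D + η) * -η = -(η / (D + η)) := by ring
    rw [this, Real.rpow_neg (by positivity), ← Real.inv_rpow (by positivity)]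
    have : (η * β / (P * D))⁻¹ = (P * D / η) * β⁻¹ := by field_simp
    rw [this, Real.mul_rpow (by positivity) (by positivity), Real.inv_rpow hβ.le]
    have : D / (D + η) = 1 - η / (D + η) := by field_simp; ring
    rw [this, Real.rpow_sub hβ, Real.rpow_one]
    ring
  rw [h2, mul_assoc, ← h3]
  field_simp
  ring

lemma aux_radial {d : ℕ} (A s : ℝ) :
    ContDiff ℝ 3 (fun x : Euc d => A * (1 + ‖x‖ ^ 2) ^ s) ∧
    (∀ x : Euc d, gradient (fun x : Euc d => A * (1 + ‖x‖ ^ 2) ^ s) x =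
      (2 * A * s * (1 + ‖x‖ ^ 2) ^ (s - 1)) • x) ∧
    (∀ x : Euc d, lap (fun x : Euc d => A * (1 + ‖x‖ ^ 2) ^ s) x =
      d * (2 * A * s * (1 + ‖x‖ ^ 2) ^ (s - 1)) +
        4 * A * s * (s - 1) * (1 + ‖x‖ ^ 2) ^ (s - 2) * ‖x‖ ^ 2) := by
  have hpos : ∀ x : Euc d, 1 + ‖x‖ ^ 2 ≠ 0 := fun x => by positivity
  have hbase : ∀ x : Euc d, HasFDerivAt (fun x : Euc d => 1 + ‖x‖ ^ 2) (2 • innerSL ℝ x) x := fun x =>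
    (hasStrictFDerivAt_norm_sq x).hasFDerivAt.const_add 1
  have hf : ∀ (A s : ℝ) (x : Euc d), HasFDerivAt (fun x : Euc d => A * (1 + ‖x‖ ^ 2) ^ s)
      ((2 * A * s * (1 + ‖x‖ ^ 2) ^ (s - 1)) • innerSL ℝ x) x := by
    intro A s x
    have := ((hbase x).rpow_const (p := s) (Or.inl (hpos x))).const_mul A
    refine this.congr_fderiv ?_
    refine ContinuousLinearMap.ext fun v => ?_
    change A * (s * (1 + ‖x‖ ^ 2) ^ (s - 1) * ((2 : ℕ) • ⟪x, v⟫)) =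
      2 * A * s * (1 + ‖x‖ ^ 2) ^ (s - 1) * ⟪x, v⟫
    rw [nsmul_eq_mul]
    push_cast
    ring
  have hg : ∀ x v : Euc d, fderiv ℝ (fun x : Euc d => A * (1 + ‖x‖ ^ 2) ^ s) x v =
      (2 * A * s * (1 + ‖x‖ ^ 2) ^ (s - 1)) * ⟪x, v⟫ := by
    intro x v
    rw [(hf A s x).fderiv]; simp
  refine ⟨?_, ?_, ?_⟩
  · exact contDiff_const.mul
      ((contDiff_const.add (contDiff_norm_sq ℝ)).rpow_const_of_ne hpos)
  · intro x
    refine ext_inner_right ℝ fun v => ?_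
    rw [inner_gradient_left, hg, real_inner_smul_left]
  · intro x
    unfold lap
    simp_rw [hg]
    have h2 : ∀ i : Fin d, fderiv ℝ (fun y : Euc d => 2 * A * s * (1 + ‖y‖ ^ 2) ^ (s - 1) *
        ⟪y, EuclideanSpace.single i (1:ℝ)⟫) x (EuclideanSpace.single i (1:ℝ)) =
        2 * A * s * (1 + ‖x‖ ^ 2) ^ (s - 1) +
        4 * A * s * (s - 1) * (1 + ‖x‖ ^ 2) ^ (s - 2) * x i ^ 2 := by
      intro i
      have e1 : HasFDerivAt (fun y : Euc d => ⟪y, EuclideanSpace.single i (1:ℝ)⟫)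
          (innerSL ℝ (EuclideanSpace.single i (1:ℝ))) x := by
        have := (innerSL ℝ (EuclideanSpace.single i (1:ℝ) : Euc d)).hasFDerivAt (x := x)
        refine this.congr_of_eventuallyEq (Eventually.of_forall fun y => ?_)
        simp [real_inner_comm]
      have e2 := (hf (2 * A * s) (s - 1) x).mul e1
      have e3 := e2.fderiv
      have e4 : fderiv ℝ (fun y : Euc d => 2 * A * s * (1 + ‖y‖ ^ 2) ^ (s - 1) *
        ⟪y, EuclideanSpace.single i (1:ℝ)⟫) x = _ := e3
      rw [e4]
      have hss : s - 1 - 1 = s - 2 := by ring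
      simp [EuclideanSpace.inner_single_right, hss]
      ring
    rw [Finset.sum_congr rfl fun i _ => h2 i, Finset.sum_add_distrib,
      EuclideanSpace.real_norm_sq_eq x, Finset.mul_sum]
    simp

lemma aux_asym (m mst δ ρ a C K s : ℝ) (hm : 1 < m) (hmst : mst = m / (m - 1)) (hδ : 0 < δ)
    (hρ : 0 < ρ) (hK : K = ρ ^ (mst - 1)) (hs : s = (δ * (mst - 1) + 1) / 2) (L : ℝ) (hL : L < 1) :
    ∀ᶠ r : ℝ in atTop, C * (1 + r ^ 2) ^ (s - 1) - (ρ + a * r⁻¹) * r ^ (δ - 1) * (K * (1 + r ^ 2) ^ (s - 1)) * r ^ 2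
      + (1 / m) * (K * (1 + r ^ 2) ^ (s - 1) * r) ^ m ≤ - (L * (ρ ^ mst / mst) * r ^ (δ * mst)) := by
  have hm1 : 0 < m - 1 := by linarith
  have hm0 : 0 < m := by linarith
  have hmst0 : 0 < mst := by rw [hmst]; positivity
  have hK0 : 0 < K := by rw [hK]; positivity
  have hmm : (mst - 1) * m = mst := by rw [hmst]; field_simp; ring
  have hu : Tendsto (fun r : ℝ => (1 + r⁻¹ ^ 2) ^ (s - 1)) atTop (nhds 1) := by
    have : Tendsto (fun r : ℝ => 1 + r⁻¹ ^ 2) atTop (nhds (1 + 0 ^ 2)) :=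
      (tendsto_inv_atTop_zero.pow 2).const_add 1
    have := this.rpow_const (p := s - 1) (Or.inl (by norm_num))
    simpa using this
  have hlim : Tendsto (fun r : ℝ => C * r ^ (-(1 + δ)) * (1 + r⁻¹ ^ 2) ^ (s - 1)
      - (ρ + a * r⁻¹) * (K * (1 + r⁻¹ ^ 2) ^ (s - 1)) + (1 / m) * (K ^ m * ((1 + r⁻¹ ^ 2) ^ (s - 1)) ^ m))
      atTop (nhds (C * 0 * 1 - (ρ + a * 0) * (K * 1) + (1 / m) * (K ^ m * 1 ^ m))) := by
    refine Tendsto.add (Tendsto.sub ?_ ?_) ?_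
    · exact ((tendsto_rpow_neg_atTop (by linarith : 0 < 1 + δ)).const_mul C).mul hu
    · exact ((tendsto_inv_atTop_zero.const_mul a).const_add ρ).mul (hu.const_mul K)
    · exact ((hu.rpow_const (Or.inl one_ne_zero)).const_mul (K ^ m)).const_mul (1 / m)
  have hval : C * 0 * 1 - (ρ + a * 0) * (K * 1) + (1 / m) * (K ^ m * 1 ^ m) = - (ρ ^ mst / mst) := by
    have k1 : K ^ m = ρ ^ mst := by rw [hK, ← Real.rpow_mul hρ.le, hmm]
    have k2 : ρ * K = ρ ^ mst := by
      rw [hK, Real.rpow_sub hρ, Real.rpow_one]; field_simp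
    rw [k1, Real.one_rpow]
    have : 1 / m = 1 - 1 / mst := by rw [hmst]; field_simp; ring
    rw [this]
    linear_combination -k2
  rw [hval] at hlim
  have hP : 0 < ρ ^ mst / mst := by positivity
  have hev := hlim.eventually (gt_mem_nhds (show -(ρ ^ mst / mst) < -(L * (ρ ^ mst / mst)) by nlinarith))
  filter_upwards [hev, eventually_gt_atTop 0] with r hr hr0
  set u := (1 + r⁻¹ ^ 2) ^ (s - 1) with hudef
  have hu0 : 0 < u := by positivity
  have hrel : (1 + r ^ 2) ^ (s - 1) = r ^ (δ * (mst - 1) - 1) * u := by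
    have : 1 + r ^ 2 = r ^ (2:ℝ) * (1 + r⁻¹ ^ 2) := by
      rw [Real.rpow_two]; field_simp; ring
    rw [this, Real.mul_rpow (by positivity) (by positivity), ← Real.rpow_mul hr0.le]
    have h2s : 2 * (s - 1) = δ * (mst - 1) - 1 := by rw [hs]; ring
    rw [h2s]
  have r1 : r ^ (δ * (mst - 1) - 1) = r ^ (δ * mst) * r ^ (-(1 + δ)) := by
    rw [← Real.rpow_add hr0]; congr 1; ring
  have r2 : r ^ (δ - 1) * r ^ (δ * (mst - 1) - 1) * r ^ 2 = r ^ (δ * mst) := by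
    rw [← Real.rpow_two, ← Real.rpow_add hr0, ← Real.rpow_add hr0]; congr 1; ring
  have r3 : (r ^ (δ * (mst - 1) - 1) * r) ^ m = r ^ (δ * mst) := by
    have : r ^ (δ * (mst - 1) - 1) * r = r ^ (δ * (mst - 1)) := by
      rw [Real.rpow_sub_one hr0.ne']; field_simp
    rw [this, ← Real.rpow_mul hr0.le, mul_assoc, hmm]
  have r4 : (K * (r ^ (δ * (mst - 1) - 1) * u) * r) ^ m = K ^ m * u ^ m * r ^ (δ * mst) := by
    rw [← r3, ← Real.mul_rpow hK0.le hu0.le, ← Real.mul_rpow (by positivity) (by positivity)]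
    congr 1; ring
  rw [hrel, r4]
  have : C * (r ^ (δ * (mst - 1) - 1) * u) - (ρ + a * r⁻¹) * r ^ (δ - 1) * (K * (r ^ (δ * (mst - 1) - 1) * u)) * r ^ 2
      + (1 / m) * (K ^ m * u ^ m * r ^ (δ * mst)) = r ^ (δ * mst) * (C * r ^ (-(1 + δ)) * u
      - (ρ + a * r⁻¹) * (K * u) + (1 / m) * (K ^ m * u ^ m)) := by
    rw [show (ρ + a * r⁻¹) * r ^ (δ - 1) * (K * (r ^ (δ * (mst - 1) - 1) * u)) * r ^ 2 =
      (ρ + a * r⁻¹) * (K * u) * (r ^ (δ - 1) * r ^ (δ * (mst - 1) - 1) * r ^ 2) by ring, r2, r1]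
    ring
  rw [this]
  have := mul_le_mul_of_nonneg_left hr.le (Real.rpow_nonneg hr0.le (δ * mst))
  linarith

lemma aux_lower (d : ℕ) (m δ ρ R a η : ℝ) (hm : 1 < m)
    (hδ : 0 < δ) (hρ : 0 < ρ) (hη : 0 < η) (hR : 0 < R)
    (mst : ℝ) (hmst : mst = m / (m - 1))
    (c₀ : ℝ) (hc₀ : c₀ = ((δ * mst + η) / (δ * mst)) * (ρ ^ mst * δ / η) ^ (η / (δ * mst + η)))
    (b : Euc d → Euc d) (V : Euc d → ℝ) (α : Euc d → ℝ)
    (hH1 : HypH1 δ ρ R a η b V α) (L : ℝ) (hL0 : 0 < L) (hL : L < 1) :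
    ∀ᶠ β : ℝ in atTop, ∃ φ : Euc d → ℝ,
      IsSubsol m b V β (L * (c₀ * β ^ (δ * mst / (δ * mst + η)))) φ := by
  obtain ⟨⟨hb, hV, -, hα, hbx, -, hV0, hsupp, -⟩, h1⟩ := hH1
  have hm1 : 0 < m - 1 := by linarith
  have hm0 : 0 < m := by linarith
  have hmst0 : 0 < mst := by rw [hmst]; positivity
  have hmst1 : 1 < mst := by rw [hmst, one_lt_div hm1]; linarith
  have hD : 0 < δ * mst := by positivity
  set P := ρ ^ mst / mst with hP
  have hP0 : 0 < P := by positivity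
  have hc₀' : c₀ = ((δ * mst + η) / (δ * mst)) * (P * (δ * mst) / η) ^ (η / (δ * mst + η)) := by
    rw [hc₀, hP]; congr 3; field_simp
  have hc₀0 : 0 < c₀ := by rw [hc₀]; positivity
  obtain ⟨s, hs⟩ : ∃ s, s = (δ * (mst - 1) + 1) / 2 := ⟨_, rfl⟩
  have hs0 : 0 < s := by
    rw [hs]
    have : 0 < δ * (mst - 1) := mul_pos hδ (by linarith)
    linarith
  obtain ⟨K, hK⟩ : ∃ K, K = ρ ^ (mst - 1) := ⟨_, rfl⟩
  have hK0 : 0 < K := by rw [hK]; positivity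
  set C : ℝ := K * (d + 2 * |s - 1|) with hC
  obtain ⟨R₁, hR₁⟩ := eventually_atTop.1 (aux_asym m mst δ ρ a C K s hm hmst hδ hρ hK hs L hL)
  set R₂ := max R R₁ with hR₂
  have hR₂0 : 0 < R₂ := lt_of_lt_of_le hR (le_max_left _ _)
  obtain ⟨hφ, hgrad, hlap⟩ := aux_radial (d := d) (-K / (2 * s)) s
  set φ : Euc d → ℝ := fun x => -K / (2 * s) * (1 + ‖x‖ ^ 2) ^ s with hφdef
  have hAs : 2 * (-K / (2 * s)) * s = -K := by field_simp
  have hgrad' : ∀ x, gradient φ x = (-(K * (1 + ‖x‖ ^ 2) ^ (s - 1))) • x := by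
    intro x; rw [hgrad, hAs]; congr 1; ring
  have hlap' : ∀ x, lap φ x = -(K * (d * (1 + ‖x‖ ^ 2) ^ (s - 1) +
      2 * (s - 1) * (1 + ‖x‖ ^ 2) ^ (s - 2) * ‖x‖ ^ 2)) := by
    intro x; rw [hlap, hAs, show 4 * (-K / (2 * s)) * s = 2 * (2 * (-K / (2 * s)) * s) by ring, hAs]; ring
  have hnorm : ∀ x, ‖gradient φ x‖ = K * (1 + ‖x‖ ^ 2) ^ (s - 1) * ‖x‖ := by
    intro x
    rw [hgrad', norm_smul, norm_neg, Real.norm_of_nonneg (by positivity)]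
  have hlapb : ∀ x, - lap φ x ≤ C * (1 + ‖x‖ ^ 2) ^ (s - 1) := by
    intro x
    rw [hlap', neg_neg, hC, mul_assoc K]
    gcongr
    rw [add_mul]
    refine add_le_add le_rfl ?_
    have h3 : (1 + ‖x‖ ^ 2) ^ (s - 2) * ‖x‖ ^ 2 ≤ (1 + ‖x‖ ^ 2) ^ (s - 1) := by
      have : (1 + ‖x‖ ^ 2) ^ (s - 1) = (1 + ‖x‖ ^ 2) ^ (s - 2) * (1 + ‖x‖ ^ 2) := by
        rw [← Real.rpow_add_one (by positivity)]; congr 1; ring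
      rw [this]
      gcongr
      linarith
    calc 2 * (s - 1) * (1 + ‖x‖ ^ 2) ^ (s - 2) * ‖x‖ ^ 2
        = 2 * (s - 1) * ((1 + ‖x‖ ^ 2) ^ (s - 2) * ‖x‖ ^ 2) := by ring
      _ ≤ 2 * |s - 1| * ((1 + ‖x‖ ^ 2) ^ (s - 2) * ‖x‖ ^ 2) := by
          gcongr
          exact le_abs_self _
      _ ≤ _ := by gcongr
  -- the inner region
  have hVpos : ∀ x, 0 < V x := by
    intro x
    rcases le_total ‖x‖ R with h | h
    · have : x ∈ Function.support V := interior_subset (hsupp (by simpa using h))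
      exact lt_of_le_of_ne (hV0 x) (Ne.symm this)
    · rw [(h1 x h).2]
      exact Real.rpow_pos_of_pos (lt_of_lt_of_le hR h) _
  have hcomp : IsCompact (Metric.closedBall (0 : Euc d) R₂) := isCompact_closedBall _ _
  obtain ⟨x₁, -, hx₁⟩ := hcomp.exists_isMinOn ⟨0, by simpa using hR₂0.le⟩ hV.continuous.continuousOn
  set v := V x₁ with hv
  have hv0 : 0 < v := hVpos x₁
  obtain ⟨M, hM⟩ : ∃ M, ∀ x ∈ Metric.closedBall (0 : Euc d) R₂,
      ‖C * (1 + ‖x‖ ^ 2) ^ (s - 1) + ⟪b x, (-(K * (1 + ‖x‖ ^ 2) ^ (s - 1))) • x⟫ +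
      (1 / m) * (K * (1 + ‖x‖ ^ 2) ^ (s - 1) * ‖x‖) ^ m‖ ≤ M := by
    apply hcomp.exists_bound_of_continuousOn
    apply Continuous.continuousOn
    have c1 : Continuous (fun x : Euc d => (1 + ‖x‖ ^ 2) ^ (s - 1)) := by
      apply Continuous.rpow_const (by fun_prop)
      intro x; left; positivity
    have c2 := hb.continuous
    refine ((c1.const_mul C).add (c2.inner ((c1.const_mul K).neg.smul continuous_id))).add ?_
    exact (((c1.const_mul K).mul continuous_norm).rpow_const (fun x => Or.inr hm0.le)).const_mul _
  set θ := δ * mst / (δ * mst + η) with hθ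
  have hθ0 : 0 < θ := by positivity
  have hθ1 : θ < 1 := by rw [hθ, div_lt_one (by positivity)]; linarith
  have hbig : ∀ᶠ β : ℝ in atTop, L * (c₀ * β ^ θ) + M - β * v ≤ 0 := by
    have t1 : Tendsto (fun β : ℝ => L * (c₀ * β ^ (-(1 - θ))) + M * β⁻¹) atTop
        (nhds (L * (c₀ * 0) + M * 0)) :=
      (((tendsto_rpow_neg_atTop (by linarith : 0 < 1 - θ)).const_mul c₀).const_mul L).add
        (tendsto_inv_atTop_zero.const_mul M)
    have := t1.eventually (gt_mem_nhds (show L * (c₀ * 0) + M * 0 < v by simpa using hv0))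
    filter_upwards [this, eventually_gt_atTop 0] with β hβ hβ0
    have e : β ^ θ = β * β ^ (-(1 - θ)) := by
      rw [mul_comm, ← Real.rpow_add_one hβ0.ne']; congr 1; ring
    have h5 := mul_le_mul_of_nonneg_left hβ.le hβ0.le
    have h6 : β * (L * (c₀ * β ^ (-(1 - θ))) + M * β⁻¹) = L * (c₀ * β ^ θ) + M := by
      rw [e]; field_simp
    linarith
  filter_upwards [hbig, eventually_gt_atTop 0] with β hβ hβ0
  refine ⟨φ, hφ, fun x => ?_⟩
  rw [hnorm, hgrad']
  have hl := hlapb x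
  rcases le_total ‖x‖ R₂ with h | h
  · have k1 := (le_abs_self _).trans (hM x (by simpa using h))
    have k2 : v ≤ V x := hx₁ (by simpa using h)
    have k3 : β * v ≤ β * V x := by gcongr
    linarith
  · have hxR : R ≤ ‖x‖ := (le_max_left _ _).trans h
    have hx0 : 0 < ‖x‖ := hR.trans_le hxR
    have k1 := hR₁ ‖x‖ ((le_max_right _ _).trans h)
    have k2 := aux_min_le (δ * mst) η P β ‖x‖ hD hη hP0 hβ0 hx0
    rw [← hc₀'] at k2
    have k3 : ⟪b x, (-(K * (1 + ‖x‖ ^ 2) ^ (s - 1))) • x⟫ =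
        - ((ρ + a * ‖x‖⁻¹) * ‖x‖ ^ (δ - 1) * (K * (1 + ‖x‖ ^ 2) ^ (s - 1)) * ‖x‖ ^ 2) := by
      rw [hbx x hxR, (h1 x hxR).1, real_inner_smul_left, real_inner_smul_right,
        real_inner_self_eq_norm_sq]
      ring
    rw [k3, (h1 x hxR).2]
    have k4 := mul_le_mul_of_nonneg_left k2 hL0.le
    have k5 : L * (β * ‖x‖ ^ (-η)) ≤ β * ‖x‖ ^ (-η) := by
      have : 0 ≤ β * ‖x‖ ^ (-η) := by positivity
      nlinarith
    linarith

lemma aux_upper_fin (d : ℕ) (hd : 1 ≤ d) (m δ ρ R a η : ℝ) (hm : 1 < m)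
    (hδ : 0 < δ) (hρ : 0 < ρ) (hη : 0 < η)
    (mst : ℝ) (hmst : mst = m / (m - 1))
    (c₀ : ℝ) (hc₀ : c₀ = ((δ * mst + η) / (δ * mst)) * (ρ ^ mst * δ / η) ^ (η / (δ * mst + η)))
    (b : Euc d → Euc d) (V : Euc d → ℝ) (α : Euc d → ℝ)
    (hH1 : HypH1 δ ρ R a η b V α) (κ : ℝ) (hκ : 1 < κ) :
    ∃ C : ℝ, ∀ᶠ β : ℝ in atTop, ∀ (lam : ℝ) (φ : Euc d → ℝ), IsSubsol m b V β lam φ →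
      lam ≤ C + κ * (c₀ * β ^ (δ * mst / (δ * mst + η))) := by
  obtain ⟨⟨-, -, -, -, hbx, -, -, -, -⟩, h1⟩ := hH1
  have hm1 : 0 < m - 1 := by linarith
  have hm0 : 0 < m := by linarith
  have hmst0 : 0 < mst := by rw [hmst]; positivity
  have hD : 0 < δ * mst := by positivity
  set P := ρ ^ mst / mst with hP
  have hP0 : 0 < P := by positivity
  have hc₀' : c₀ = ((δ * mst + η) / (δ * mst)) * (P * (δ * mst) / η) ^ (η / (δ * mst + η)) := by
    rw [hc₀, hP]; congr 3; field_simp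
  set κ' := (1 + κ) / 2 with hκ'
  have hκ'1 : 1 < κ' := by rw [hκ']; linarith
  have hκ'κ : κ' < κ := by rw [hκ']; linarith
  have hκ'0 : 0 < κ' := by linarith
  set μ := κ' ^ (-(1 / mst)) with hμ
  have hμ0 : 0 < μ := by positivity
  have hμ1 : μ < 1 := Real.rpow_lt_one_of_one_lt_of_neg hκ'1 (by rw [neg_lt_zero]; positivity)
  have hμm : μ ^ mst = κ'⁻¹ := by
    rw [hμ, ← Real.rpow_mul hκ'0.le]
    have : -(1 / mst) * mst = -1 := by field_simp
    rw [this, Real.rpow_neg_one]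
  obtain ⟨C, hC⟩ := aux_upper d m mst hm hmst μ hμ0 hμ1
  refine ⟨C, ?_⟩
  -- limits in r
  have ti : Tendsto (fun r : ℝ => r⁻¹) atTop (nhds 0) := tendsto_inv_atTop_zero
  have ti1 : Tendsto (fun r : ℝ => (r - 1)⁻¹) atTop (nhds 0) :=
    tendsto_inv_atTop_zero.comp (tendsto_atTop_add_const_right _ (-1) tendsto_id)
  have tX : Tendsto (fun r : ℝ => κ' * ((ρ + |a| * (r - 1)⁻¹) * (1 + r⁻¹) ^ δ) ^ mst) atTop
      (nhds (κ' * ((ρ + |a| * 0) * (1 + 0) ^ δ) ^ mst)) :=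
    ((((ti1.const_mul |a|).const_add ρ).mul ((ti.const_add 1).rpow_const (Or.inl (by norm_num)))).rpow_const
      (Or.inr hmst0.le)).const_mul κ'
  have tY : Tendsto (fun r : ℝ => (1 - r⁻¹) ^ (-η)) atTop (nhds ((1 - 0) ^ (-η))) :=
    (ti.const_sub 1).rpow_const (Or.inl (by norm_num))
  have eX := tX.eventually (gt_mem_nhds (show κ' * ((ρ + |a| * 0) * (1 + 0) ^ δ) ^ mst < κ * ρ ^ mst by
    simp only [mul_zero, add_zero, Real.one_rpow, mul_one]
    have : 0 < ρ ^ mst := by positivity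
    nlinarith))
  have eY := tY.eventually (gt_mem_nhds (show ((1:ℝ) - 0) ^ (-η) < κ by simpa using hκ))
  have hrt : Tendsto (fun β : ℝ => (η * β / (P * (δ * mst))) ^ (1 / (δ * mst + η))) atTop atTop := by
    refine (tendsto_rpow_atTop (by positivity)).comp ?_
    exact (tendsto_id.const_mul_atTop hη).atTop_div_const (by positivity)
  have eall := hrt.eventually (eX.and (eY.and (eventually_gt_atTop (max R 0 + 1))))
  filter_upwards [eall, eventually_gt_atTop 0] with β hβ hβ0 lam φ hsub
  obtain ⟨r, hr⟩ : ∃ r, r = (η * β / (P * (δ * mst))) ^ (1 / (δ * mst + η)) := ⟨_, rfl⟩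
  rw [← hr] at hβ
  obtain ⟨hX, hY, hrR⟩ := hβ
  have hr1 : 1 < r := by have := le_max_right R 0; linarith
  have hr0 : 0 < r := by linarith
  have hr10 : 0 < r - 1 := by linarith
  have hrR' : R < r - 1 := by have := le_max_left R 0; linarith
  let e : Euc d := EuclideanSpace.single ⟨0, hd⟩ (1:ℝ)
  have he : ‖e‖ = 1 := by simp [e]
  have hnx : ∀ x : Euc d, ‖x - r • e‖ ≤ 1 → r - 1 ≤ ‖x‖ ∧ ‖x‖ ≤ r + 1 := by
    intro x hx
    have h2 : ‖r • e‖ = r := by rw [norm_smul, he, mul_one, Real.norm_of_nonneg hr0.le]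
    have h3 := norm_sub_norm_le (r • e) x
    have h4 := norm_sub_norm_le x (r • e)
    rw [norm_sub_rev] at h3
    constructor <;> linarith
  have main := hC b V β lam φ (r • e) ((ρ + |a| * (r - 1)⁻¹) * (r + 1) ^ δ) ((r - 1) ^ (-η))
    hβ0.le (by positivity) ?_ hsub
  · have z1 : (ρ + |a| * (r - 1)⁻¹) * (r + 1) ^ δ =
        ((ρ + |a| * (r - 1)⁻¹) * (1 + r⁻¹) ^ δ) * r ^ δ := by
      rw [mul_assoc, ← Real.mul_rpow (by positivity) hr0.le]
      congr 2; field_simp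
    have z2 : (r - 1) ^ (-η) = (1 - r⁻¹) ^ (-η) * r ^ (-η) := by
      have : 0 ≤ 1 - r⁻¹ := by
        have := inv_le_one_of_one_le₀ hr1.le; linarith
      rw [← Real.mul_rpow this hr0.le]
      congr 1; field_simp
    have z3 : (((ρ + |a| * (r - 1)⁻¹) * (r + 1) ^ δ) / μ) ^ mst / mst =
        (κ' * ((ρ + |a| * (r - 1)⁻¹) * (1 + r⁻¹) ^ δ) ^ mst) * r ^ (δ * mst) / mst := by
      rw [Real.div_rpow (by positivity) hμ0.le, hμm, z1, Real.mul_rpow (by positivity) (by positivity),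
        ← Real.rpow_mul hr0.le, div_inv_eq_mul]
      ring
    have z4 : (κ' * ((ρ + |a| * (r - 1)⁻¹) * (1 + r⁻¹) ^ δ) ^ mst) * r ^ (δ * mst) / mst ≤
        κ * ρ ^ mst * r ^ (δ * mst) / mst := by gcongr
    have z5 : β * (r - 1) ^ (-η) ≤ β * (κ * r ^ (-η)) := by rw [z2]; gcongr
    have z6 := aux_min_eq (δ * mst) η P β r hD hη hP0 hβ0 hr
    rw [← hc₀'] at z6
    rw [z3] at main
    rw [← z6]
    have z7 : κ * ρ ^ mst * r ^ (δ * mst) / mst = κ * (P * r ^ (δ * mst)) := by rw [hP]; ring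
    linarith
  · intro x hx
    obtain ⟨h3, h4⟩ := hnx x hx
    have hxR : R ≤ ‖x‖ := by linarith
    have hx0 : 0 < ‖x‖ := by linarith
    constructor
    · rw [hbx x hxR, (h1 x hxR).1, norm_smul, norm_mul]
      have w1 : ‖ρ + a * ‖x‖⁻¹‖ ≤ ρ + |a| * (r - 1)⁻¹ := by
        refine (norm_add_le _ _).trans ?_
        rw [Real.norm_of_nonneg hρ.le, norm_mul, norm_inv, norm_norm, Real.norm_eq_abs]
        gcongr
      have w2 : ‖‖x‖ ^ (δ - 1)‖ * ‖x‖ = ‖x‖ ^ δ := by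
        rw [Real.norm_of_nonneg (by positivity), Real.rpow_sub_one hx0.ne']
        field_simp
      rw [mul_assoc, w2]
      gcongr
    · rw [(h1 x hxR).2]
      exact Real.rpow_le_rpow_of_nonpos hr10 h3 (by linarith)

/-- sharp asymptotics of `λ_max(β)` in the strong drift case `δ > 0`. -/
theorem stmt0 (d : ℕ) (hd : 1 ≤ d) (m δ ρ R a η : ℝ) (hm : 1 < m)
    (hδ : 0 < δ) (hρ : 0 < ρ) (hη : 0 < η) (hR : 0 < R)
    (mst : ℝ) (hmst : mst = m / (m - 1))
    (c₀ : ℝ) (hc₀ : c₀ = ((δ * mst + η) / (δ * mst)) * (ρ ^ mst * δ / η) ^ (η / (δ * mst + η)))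
    (b : Euc d → Euc d) (V : Euc d → ℝ) (α : Euc d → ℝ)
    (hH1 : HypH1 δ ρ R a η b V α) :
    Tendsto (fun β : ℝ => β ^ (-(δ * mst) / (δ * mst + η)) * lamMax m b V β)
      atTop (nhds c₀) := by
  have hm1 : 0 < m - 1 := by linarith
  have hmst0 : 0 < mst := by rw [hmst]; positivity
  have hc₀0 : 0 < c₀ := by rw [hc₀]; positivity
  set θ := δ * mst / (δ * mst + η) with hθ
  have hθ0 : 0 < θ := by positivity
  have hneg : -(δ * mst) / (δ * mst + η) = -θ := by rw [hθ]; ring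
  rw [hneg]
  have lower := aux_lower d m δ ρ R a η hm hδ hρ hη hR mst hmst c₀ hc₀ b V α hH1
  have upper := aux_upper_fin d hd m δ ρ R a η hm hδ hρ hη mst hmst c₀ hc₀ b V α hH1
  have hcancel : ∀ β : ℝ, 0 < β → β ^ (-θ) * β ^ θ = 1 := by
    intro β hβ
    rw [← Real.rpow_add hβ, neg_add_cancel, Real.rpow_zero]
  rw [tendsto_order]
  constructor
  · intro c hc
    obtain ⟨C, hC⟩ := upper 2 (by norm_num)
    obtain ⟨L, hL1, hL2⟩ := exists_between (show max (c / c₀) 0 < 1 by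
      rw [max_lt_iff, div_lt_one hc₀0]; exact ⟨hc, one_pos⟩)
    have hL0 : 0 < L := (le_max_right _ _).trans_lt hL1
    have hcL : c < L * c₀ := by
      rw [← div_lt_iff₀ hc₀0]; exact (le_max_left _ _).trans_lt hL1
    filter_upwards [lower L hL0 hL2, hC, eventually_gt_atTop 0] with β h1 h2 hβ
    have hle : L * (c₀ * β ^ θ) ≤ lamMax m b V β :=
      le_csSup ⟨_, fun lam ⟨φ, hφ⟩ => h2 lam φ hφ⟩ h1
    have hp : 0 ≤ β ^ (-θ) := by positivity
    have h3 := mul_le_mul_of_nonneg_left hle hp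
    have h4 : β ^ (-θ) * (L * (c₀ * β ^ θ)) = L * c₀ * (β ^ (-θ) * β ^ θ) := by ring
    rw [h4, hcancel β hβ, mul_one] at h3
    linarith
  · intro c hc
    obtain ⟨κ, hκ1, hκ2⟩ := exists_between (show 1 < c / c₀ by rwa [one_lt_div hc₀0])
    rw [lt_div_iff₀ hc₀0] at hκ2
    obtain ⟨C, hC⟩ := upper κ hκ1
    have t : Tendsto (fun β : ℝ => β ^ (-θ) * C + κ * c₀) atTop (nhds (0 * C + κ * c₀)) :=
      ((tendsto_rpow_neg_atTop hθ0).mul_const C).add_const _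
    have ht := t.eventually (gt_mem_nhds (show 0 * C + κ * c₀ < c by simpa using hκ2))
    filter_upwards [lower (1 / 2) (by norm_num) (by norm_num), hC, ht, eventually_gt_atTop 0]
      with β h1 h2 h3 hβ
    have hle : lamMax m b V β ≤ C + κ * (c₀ * β ^ θ) :=
      csSup_le ⟨_, h1⟩ fun lam ⟨φ, hφ⟩ => h2 lam φ hφ
    have hp : 0 ≤ β ^ (-θ) := by positivity
    have h5 := mul_le_mul_of_nonneg_left hle hp
    have h4 : β ^ (-θ) * (C + κ * (c₀ * β ^ θ)) = β ^ (-θ) * C + κ * c₀ * (β ^ (-θ) * β ^ θ) := by ring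
    rw [h4, hcancel β hβ, mul_one] at h5
    linarith


end
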